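/- arXiv:2303.03358 — 6 statements merged into one kernel-verified Lean document; each statement's English description precedes it below -/
import Mathlib

section
/- Let A be a d×d real symmetric matrix, b ∈ R^d, and k a positive integer with dim K_k(A,b) = k. Let Q be a d×k matrix with orthonormal columns spanning K_k(A,b) and T = Qᵀ A Q. For any polynomial n with deg(n) < k, one has Q n(T) Qᵀ b = n(A) b; that is, the Lanczos-FA iterate is exact for polynomials of degree less than k. -/
open Matrix Polynomial

noncomputable section

/-- Euclidean norm of a vector in `ℝ^d`. -/
def enorm {d : ℕ} (x : Fin d → ℝ) : ℝ := Real.sqrt (x ⬝ᵥ x)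

/-- The `M`-weighted norm `‖x‖_M = √(xᵀ M x)`. -/
def mnorm {d : ℕ} (M : Matrix (Fin d) (Fin d) ℝ) (x : Fin d → ℝ) : ℝ :=
  Real.sqrt (x ⬝ᵥ M *ᵥ x)

/-- Krylov subspace `K_k(A,b) = span{b, Ab, ..., A^{k-1} b}`. -/
def Krylov {d : ℕ} (A : Matrix (Fin d) (Fin d) ℝ) (b : Fin d → ℝ) (k : ℕ) :
    Submodule ℝ (Fin d → ℝ) :=
  Submodule.span ℝ (Set.range fun j : Fin k => (A ^ (j : ℕ)) *ᵥ b)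

/-- Smallest eigenvalue of a symmetric matrix (junk value `0` otherwise). -/
def lammin {d : ℕ} (M : Matrix (Fin d) (Fin d) ℝ) : ℝ :=
  if h : M.IsHermitian then ⨅ i, h.eigenvalues i else 0

/-- Largest eigenvalue of a symmetric matrix (junk value `0` otherwise). -/
def lammax {d : ℕ} (M : Matrix (Fin d) (Fin d) ℝ) : ℝ :=
  if h : M.IsHermitian then ⨆ i, h.eigenvalues i else 0

/-- Condition number `κ(M) = λmax(M)/λmin(M)`. -/
def kappa {d : ℕ} (M : Matrix (Fin d) (Fin d) ℝ) : ℝ := lammax M / lammin M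

/-- `mij zs i j` is the polynomial `m_{i,j}(x) = ∏_{t=i}^{j} (x - z_t)`. -/
def mij (zs : ℕ → ℝ) (i j : ℕ) : Polynomial ℝ := ∏ t ∈ Finset.Icc i j, (X - C (zs t))

/-- `A_z = +(A - z I)` if `z < λmin(A)` and `-(A - z I)` otherwise; signed so as to be
positive definite when `z` lies outside the interval `[λmin(A), λmax(A)]`. -/
def shiftSgn {d : ℕ} (A : Matrix (Fin d) (Fin d) ℝ) (z : ℝ) : Matrix (Fin d) (Fin d) ℝ :=
  if z < lammin A then A - z • 1 else -(A - z • 1)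

/-- Spectral norm (ℓ²-operator norm) of a square matrix. -/
def specNorm {d : ℕ} (M : Matrix (Fin d) (Fin d) ℝ) : ℝ :=
  ‖Matrix.toEuclideanCLM (𝕜 := ℝ) M‖

/-- Matrix function `f(M)` defined via the spectral decomposition of a symmetric matrix
(junk value `0` if `M` is not symmetric). -/
def matFn {d : ℕ} (M : Matrix (Fin d) (Fin d) ℝ) (f : ℝ → ℝ) : Matrix (Fin d) (Fin d) ℝ :=
  if h : M.IsHermitian then h.cfc f else 0

/-- `Q Qᵀ` fixes the column span of a matrix `Q` with orthonormal columns. -/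
theorem mul_transpose_mulVec_of_mem_span {m l : Type*} [Fintype m] [Fintype l] [DecidableEq l]
    {Q : Matrix m l ℝ} (hQ : Qᵀ * Q = 1) {v : m → ℝ}
    (hv : v ∈ Submodule.span ℝ (Set.range fun i : l => fun j : m => Q j i)) :
    (Q * Qᵀ) *ᵥ v = v := by
  have hv' : v ∈ LinearMap.range Q.mulVecLin := by
    rw [Matrix.range_mulVecLin]
    exact hv
  obtain ⟨w, rfl⟩ := hv'
  rw [Matrix.mulVecLin_apply, Matrix.mulVec_mulVec, Matrix.mul_assoc, hQ, Matrix.mul_one]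

theorem pow_mulVec_mem_Krylov {d k j : ℕ} (A : Matrix (Fin d) (Fin d) ℝ) (b : Fin d → ℝ)
    (hj : j < k) : (A ^ j) *ᵥ b ∈ Krylov A b k :=
  Submodule.subset_span ⟨⟨j, hj⟩, rfl⟩

/-- The Lanczos-FA iterate is exact for monomials of degree `< k`. -/
theorem lanczosFA_pow_exact {d k : ℕ} (A : Matrix (Fin d) (Fin d) ℝ) (b : Fin d → ℝ)
    {Q : Matrix (Fin d) (Fin k) ℝ} (hQ : Qᵀ * Q = 1)
    (hspan : Submodule.span ℝ
      (Set.range fun i : Fin k => fun j : Fin d => Q j i) = Krylov A b k)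
    {j : ℕ} (hj : j < k) : (Q * (Qᵀ * A * Q) ^ j * Qᵀ) *ᵥ b = (A ^ j) *ᵥ b := by
  have hfix {i : ℕ} (hi : i < k) : (Q * Qᵀ) *ᵥ ((A ^ i) *ᵥ b) = (A ^ i) *ᵥ b :=
    mul_transpose_mulVec_of_mem_span hQ (hspan ▸ pow_mulVec_mem_Krylov A b hi)
  induction j with
  | zero => simpa using hfix hj
  | succ j ih =>
    have hsplit : Q * (Qᵀ * A * Q) ^ (j + 1) * Qᵀ =
        (Q * Qᵀ) * (A * (Q * (Qᵀ * A * Q) ^ j * Qᵀ)) := by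
      simp only [pow_succ', Matrix.mul_assoc]
    rw [hsplit, ← Matrix.mulVec_mulVec, ← Matrix.mulVec_mulVec b A, ih (by lia),
      Matrix.mulVec_mulVec b A, ← pow_succ', hfix hj]

/-- the Lanczos-FA iterate is exact for polynomials of degree `< k`. -/
theorem lanczosFA_poly_exact
    {d k : ℕ} (A : Matrix (Fin d) (Fin d) ℝ) (hA : A.IsHermitian) (b : Fin d → ℝ)
    (hk : 0 < k) (hdim : Module.finrank ℝ ↥(Krylov A b k) = k)
    (Q : Matrix (Fin d) (Fin k) ℝ) (hQ : Qᵀ * Q = 1)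
    (hspan : Submodule.span ℝ
      (Set.range fun i : Fin k => fun j : Fin d => Q j i) = Krylov A b k)
    (n : Polynomial ℝ) (hn : n.natDegree < k) :
    (Q * aeval (Qᵀ * A * Q) n * Qᵀ) *ᵥ b = (aeval A n) *ᵥ b := by
  simp only [aeval_eq_sum_range, Matrix.mul_sum, Matrix.sum_mul, Matrix.sum_mulVec,
    Matrix.mul_smul, Matrix.smul_mul, Matrix.smul_mulVec]
  refine Finset.sum_congr rfl fun i hi => ?_
  rw [lanczosFA_pow_exact A b hQ hspan (by have := Finset.mem_range.mp hi; lia)]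

end
end

section
/- Let A be a d×d real symmetric matrix, b ∈ R^d, k a positive integer with dim K_k(A,b) = k, Q a d×k matrix with orthonormal columns spanning K_k(A,b), and T = Qᵀ A Q. Let z be a real number outside [λmin(A), λmax(A)] and let A_z = +(A − zI) if z < λmin(A) and A_z = −(A − zI) if z > λmax(A), so that A_z is positive definite. Then for any polynomial-times-inverse function of the form r_j(x) = n(x)/∏_{i=1}^{j}(x − z_i) with z_j = z, the vector Q (T − zI)^{-1} Qᵀ r_{j−1}(A) b (where r_{j−1}(x) = n(x)/∏_{i=1}^{j−1}(x − z_i)) is the unique minimizer of ‖r_j(A)b − x‖_{A_z} over x ∈ K_k(A,b). -/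
open Matrix Polynomial

noncomputable section

lemma Matrix.IsHermitian.posDef_sub_smul_one {d : ℕ} {A : Matrix (Fin d) (Fin d) ℝ}
    (hA : A.IsHermitian) {z : ℝ} (hz : z < lammin A) : (A - z • 1).PosDef := by
  have hB : (A - z • 1).IsHermitian := hA.sub (isHermitian_one.smul (IsSelfAdjoint.all z))
  refine hB.posDef_iff_eigenvalues_pos.mpr fun i => ?_
  have hmem := hB.eigenvalues_mem_spectrum_real i
  generalize hB.eigenvalues i = μ at hmem ⊢
  rw [← Algebra.algebraMap_eq_smul_one, ← spectrum.sub_singleton_eq,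
    hA.spectrum_real_eq_range_eigenvalues] at hmem
  obtain ⟨_, ⟨l, rfl⟩, _, rfl, h⟩ := hmem
  have hl : lammin A ≤ hA.eigenvalues l := by
    rw [lammin, dif_pos hA]
    exact ciInf_le (Set.finite_range _).bddBelow l
  simp only at h
  linarith

lemma Matrix.IsHermitian.posDef_neg_sub_smul_one {d : ℕ} {A : Matrix (Fin d) (Fin d) ℝ}
    (hA : A.IsHermitian) {z : ℝ} (hz : lammax A < z) : (-(A - z • 1)).PosDef := by
  have hB : (-(A - z • 1)).IsHermitian :=
    (hA.sub (isHermitian_one.smul (IsSelfAdjoint.all z))).neg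
  refine hB.posDef_iff_eigenvalues_pos.mpr fun i => ?_
  have hmem := hB.eigenvalues_mem_spectrum_real i
  generalize hB.eigenvalues i = μ at hmem ⊢
  rw [← Algebra.algebraMap_eq_smul_one, ← spectrum.neg_eq, ← spectrum.sub_singleton_eq,
    hA.spectrum_real_eq_range_eigenvalues, Set.mem_neg] at hmem
  obtain ⟨_, ⟨l, rfl⟩, _, rfl, h⟩ := hmem
  have hl : hA.eigenvalues l ≤ lammax A := by
    rw [lammax, dif_pos hA]
    exact le_ciSup (Set.finite_range _).bddAbove l
  simp only at h
  linarith

lemma shiftSgn_posDef {d : ℕ} {A : Matrix (Fin d) (Fin d) ℝ} (hA : A.IsHermitian) {z : ℝ}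
    (hz : z < lammin A ∨ lammax A < z) : (shiftSgn A z).PosDef := by
  unfold shiftSgn
  split_ifs with h
  · exact hA.posDef_sub_smul_one h
  · exact hA.posDef_neg_sub_smul_one (hz.resolve_left h)

lemma shiftSgn_eq_or {d : ℕ} (A : Matrix (Fin d) (Fin d) ℝ) (z : ℝ) :
    shiftSgn A z = A - z • 1 ∨ shiftSgn A z = -(A - z • 1) := by
  unfold shiftSgn
  split_ifs <;> simp

/-- Pythagoras for the quadratic form of `S`. -/
lemma dotProduct_mulVec_sub_eq_add {d : ℕ} {S : Matrix (Fin d) (Fin d) ℝ} (hS : S.IsHermitian)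
    {y w x : Fin d → ℝ} (h : (w - x) ⬝ᵥ S *ᵥ (y - w) = 0) :
    (y - x) ⬝ᵥ S *ᵥ (y - x) = (y - w) ⬝ᵥ S *ᵥ (y - w) + (w - x) ⬝ᵥ S *ᵥ (w - x) := by
  have h' : (y - w) ⬝ᵥ S *ᵥ (w - x) = 0 := by
    rw [dotProduct_mulVec, ← mulVec_transpose, ← conjTranspose_eq_transpose_of_trivial, hS.eq,
      dotProduct_comm, h]
  have hyx : y - x = (y - w) + (w - x) := by abel
  rw [hyx, mulVec_add, dotProduct_add, add_dotProduct, add_dotProduct, h, h']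
  ring

/-- A vector of a subspace whose residual is `S`-orthogonal to that subspace is its unique
best approximation in the `S`-norm. -/
lemma mnorm_best_approx {d : ℕ} {S : Matrix (Fin d) (Fin d) ℝ} (hS : S.PosDef)
    {K : Submodule ℝ (Fin d → ℝ)} {y w : Fin d → ℝ} (hw : w ∈ K)
    (horth : ∀ x ∈ K, x ⬝ᵥ S *ᵥ (y - w) = 0) :
    (∀ x ∈ K, mnorm S (y - w) ≤ mnorm S (y - x)) ∧
      ∀ x ∈ K, mnorm S (y - x) = mnorm S (y - w) → x = w := by
  have hnonneg (v : Fin d → ℝ) : 0 ≤ v ⬝ᵥ S *ᵥ v := by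
    simpa using hS.posSemidef.dotProduct_mulVec_nonneg v
  have hpyth {x : Fin d → ℝ} (hx : x ∈ K) :=
    dotProduct_mulVec_sub_eq_add hS.isHermitian (horth _ (K.sub_mem hw hx))
  refine ⟨fun x hx => Real.sqrt_le_sqrt ?_, fun x hx h => ?_⟩
  · linarith [hpyth hx, hnonneg (w - x)]
  · rw [mnorm, mnorm, Real.sqrt_inj (hnonneg _) (hnonneg _), hpyth hx] at h
    by_contra hne
    have hpos := hS.dotProduct_mulVec_pos (sub_ne_zero.mpr (Ne.symm hne))
    simp only [star_trivial] at hpos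
    linarith

/-- The compression of a definite matrix to the range of an isometry is invertible. -/
lemma isUnit_compression {d k : ℕ} {S B : Matrix (Fin d) (Fin d) ℝ} (hS : S.PosDef)
    (hSB : S = B ∨ S = -B) {Q : Matrix (Fin d) (Fin k) ℝ} (hQ : Qᵀ * Q = 1) :
    IsUnit (Qᵀ * B * Q) := by
  have hinj : Function.Injective Q.mulVec := fun u v huv => by
    simpa [mulVec_mulVec, hQ] using congrArg (Qᵀ *ᵥ ·) huv
  have hu : IsUnit (Qᵀ * S * Q) := by
    simpa [conjTranspose_eq_transpose_of_trivial] using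
      (hS.conjTranspose_mul_mul_same hinj).isUnit
  rcases hSB with rfl | rfl
  · exact hu
  · simpa using hu

/-- The Galerkin residual is orthogonal to the range of `Q`. -/
lemma galerkin_orthogonal {d k : ℕ} {B : Matrix (Fin d) (Fin d) ℝ} {Q : Matrix (Fin d) (Fin k) ℝ}
    (h : IsUnit (Qᵀ * B * Q)) (c : Fin k → ℝ) (y : Fin d → ℝ) :
    (Q *ᵥ c) ⬝ᵥ B *ᵥ (y - (Q * (Qᵀ * B * Q)⁻¹ * Qᵀ) *ᵥ (B *ᵥ y)) = 0 := by
  have hcancel : Qᵀ * (B * (Q * (Qᵀ * B * Q)⁻¹ * Qᵀ * B)) = Qᵀ * B := by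
    calc _ = (Qᵀ * B * Q) * (Qᵀ * B * Q)⁻¹ * (Qᵀ * B) := by simp only [Matrix.mul_assoc]
      _ = Qᵀ * B := by
        rw [mul_nonsing_inv _ ((isUnit_iff_isUnit_det _).mp h), Matrix.one_mul]
  rw [dotProduct_comm, dotProduct_mulVec, ← mulVec_transpose, mulVec_sub, mulVec_sub]
  simp only [mulVec_mulVec]
  rw [hcancel, sub_self, zero_dotProduct]

/-- `r_{j-1}(A) = (A - z_j I) r_j(A)`. -/
lemma aeval_mul_inv_mij_pred {d : ℕ} {A : Matrix (Fin d) (Fin d) ℝ} {zs : ℕ → ℝ} {j : ℕ}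
    (hj : 1 ≤ j) (hu : IsUnit (A - zs j • 1)) (n : Polynomial ℝ) :
    aeval A n * (aeval A (mij zs 1 (j - 1)))⁻¹ =
      (A - zs j • 1) * (aeval A n * (aeval A (mij zs 1 j))⁻¹) := by
  have hlin : aeval A (X - C (zs j)) = A - zs j • 1 := by
    simp [Algebra.algebraMap_eq_smul_one]
  have hmij : mij zs 1 j = mij zs 1 (j - 1) * (X - C (zs j)) := by
    obtain ⟨i, rfl⟩ := Nat.exists_eq_add_of_le' hj
    simp [mij, Finset.prod_Icc_succ_top]
  have hcomm : (A - zs j • 1) * aeval A n = aeval A n * (A - zs j • 1) := by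
    rw [← hlin, ← map_mul, ← map_mul, mul_comm]
  rw [hmij, map_mul, hlin, Matrix.mul_inv_rev, ← Matrix.mul_assoc, hcomm, Matrix.mul_assoc,
    ← Matrix.mul_assoc (A - zs j • 1),
    mul_nonsing_inv _ ((isUnit_iff_isUnit_det _).mp hu), Matrix.one_mul]

/-- Lemma 2 of the paper: `Q (T - z_j I)⁻¹ Qᵀ r_{j-1}(A) b` is the unique
minimizer of `‖r_j(A)b - x‖_{A_j}` over the Krylov subspace, where `A_j = ±(A - z_j I)`. -/
theorem lanczosFA_opt_formula
    {d k q : ℕ} (A : Matrix (Fin d) (Fin d) ℝ) (hA : A.IsHermitian) (b : Fin d → ℝ)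
    (hk : 0 < k) (hdim : Module.finrank ℝ ↥(Krylov A b k) = k)
    (Q : Matrix (Fin d) (Fin k) ℝ) (hQ : Qᵀ * Q = 1)
    (hspan : Submodule.span ℝ
      (Set.range fun i : Fin k => fun j : Fin d => Q j i) = Krylov A b k)
    (zs : ℕ → ℝ) (j : ℕ) (hj : 1 ≤ j) (hjq : j ≤ q)
    (hz : ∀ i, 1 ≤ i → i ≤ j → zs i < lammin A ∨ lammax A < zs i)
    (n : Polynomial ℝ) :
    (Q * (Qᵀ * A * Q - zs j • 1)⁻¹ * Qᵀ) *ᵥ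
        ((aeval A n * (aeval A (mij zs 1 (j - 1)))⁻¹) *ᵥ b) ∈ Krylov A b k
    ∧ (∀ x ∈ Krylov A b k,
        mnorm (shiftSgn A (zs j))
            ((aeval A n * (aeval A (mij zs 1 j))⁻¹) *ᵥ b
              - (Q * (Qᵀ * A * Q - zs j • 1)⁻¹ * Qᵀ) *ᵥ
                  ((aeval A n * (aeval A (mij zs 1 (j - 1)))⁻¹) *ᵥ b))
          ≤ mnorm (shiftSgn A (zs j))
              ((aeval A n * (aeval A (mij zs 1 j))⁻¹) *ᵥ b - x))
    ∧ (∀ x ∈ Krylov A b k,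
        mnorm (shiftSgn A (zs j))
            ((aeval A n * (aeval A (mij zs 1 j))⁻¹) *ᵥ b - x)
          = mnorm (shiftSgn A (zs j))
              ((aeval A n * (aeval A (mij zs 1 j))⁻¹) *ᵥ b
                - (Q * (Qᵀ * A * Q - zs j • 1)⁻¹ * Qᵀ) *ᵥ
                    ((aeval A n * (aeval A (mij zs 1 (j - 1)))⁻¹) *ᵥ b))
          → x = (Q * (Qᵀ * A * Q - zs j • 1)⁻¹ * Qᵀ) *ᵥ
                  ((aeval A n * (aeval A (mij zs 1 (j - 1)))⁻¹) *ᵥ b)) := by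
  have hS := shiftSgn_posDef hA (hz j hj le_rfl)
  have hSB := shiftSgn_eq_or A (zs j)
  have hu : IsUnit (A - zs j • 1) := by
    simpa using isUnit_compression hS hSB (Q := (1 : Matrix (Fin d) (Fin d) ℝ)) (by simp)
  have hT : Qᵀ * A * Q - zs j • 1 = Qᵀ * (A - zs j • 1) * Q := by
    simp [Matrix.mul_sub, Matrix.sub_mul, hQ]
  have hK : LinearMap.range Q.mulVecLin = Krylov A b k := by
    rw [Matrix.range_mulVecLin, ← hspan]
    rfl
  have hmem (c : Fin k → ℝ) : Q *ᵥ c ∈ Krylov A b k := hK ▸ ⟨c, rfl⟩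
  rw [aeval_mul_inv_mij_pred hj hu, hT, ← mulVec_mulVec b (A - zs j • 1)]
  generalize (aeval A n * (aeval A (mij zs 1 j))⁻¹) *ᵥ b = y
  have hw : (Q * (Qᵀ * (A - zs j • 1) * Q)⁻¹ * Qᵀ) *ᵥ ((A - zs j • 1) *ᵥ y) ∈ Krylov A b k := by
    rw [Matrix.mul_assoc, ← mulVec_mulVec]
    exact hmem _
  refine ⟨hw, mnorm_best_approx hS hw fun x hx => ?_⟩
  rw [← hK] at hx
  obtain ⟨c, rfl⟩ := hx
  have horth := galerkin_orthogonal (isUnit_compression hS hSB hQ) c y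
  rcases hSB with h | h
  · rw [h]
    exact horth
  · rw [h, neg_mulVec, dotProduct_neg, neg_eq_zero]
    exact horth

end
end

section
/- Let A be a d×d real symmetric matrix, b ∈ R^d, k a positive integer with dim K_k(A,b) = k, Q a d×k matrix with orthonormal columns spanning K_k(A,b), and T = Qᵀ A Q. Let z_1, …, z_j be real numbers outside [λmin(A), λmax(A)], let r_j(x) = n(x)/∏_{i=1}^{j}(x − z_i) and r_{j−1}(x) = n(x)/∏_{i=1}^{j−1}(x − z_i) for a polynomial n, let A_j = ±(A − z_j I) be positive definite, and let opt_k(r_j; A_j) be the minimizer of ‖r_j(A)b − x‖_{A_j} over x ∈ K_k(A,b). Then the Lanczos-FA errors satisfy the one-step recursion: r_j(A)b − Q r_j(T) Qᵀ b = ( r_j(A)b − opt_k(r_j; A_j) ) + Q (T − z_j I)^{-1} Qᵀ ( r_{j−1}(A)b − Q r_{j−1}(T) Qᵀ b ). -/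
open Matrix Polynomial

noncomputable section

/-- A symmetric matrix shifted by a real number below (resp. above) all its eigenvalues, with the
matching sign, is positive definite. -/
lemma posDef_smul_sub_smul_one {d : ℕ} {A : Matrix (Fin d) (Fin d) ℝ} (hA : A.IsHermitian)
    {s z : ℝ} (h : ∀ i, 0 < s * (hA.eigenvalues i - z)) : (s • (A - z • 1)).PosDef := by
  have key : s • (A - z • 1) = (hA.eigenvectorUnitary : Matrix (Fin d) (Fin d) ℝ)
      * diagonal (fun i => s * (hA.eigenvalues i - z))
      * star (hA.eigenvectorUnitary : Matrix (Fin d) (Fin d) ℝ) := by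
    have hD : diagonal (fun i => s * (hA.eigenvalues i - z))
        = s • (diagonal (RCLike.ofReal ∘ hA.eigenvalues) - z • 1 : Matrix (Fin d) (Fin d) ℝ) := by
      ext i j
      by_cases hij : i = j <;> simp [hij, diagonal, one_apply]
    have hU : (hA.eigenvectorUnitary : Matrix (Fin d) (Fin d) ℝ)
        * star (hA.eigenvectorUnitary : Matrix (Fin d) (Fin d) ℝ) = 1 :=
      Unitary.coe_mul_star_self _
    conv_lhs => rw [hA.spectral_theorem, Unitary.conjStarAlgAut_apply]
    rw [hD, mul_smul_comm, smul_mul_assoc, mul_sub, sub_mul, mul_smul_comm, mul_one,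
      smul_mul_assoc, hU]
  rw [key, (Unitary.isUnit_coe (U := hA.eigenvectorUnitary)).posDef_star_right_conjugate_iff,
    posDef_diagonal_iff]
  exact h

/-- Outside `[λmin(A), λmax(A)]` the matrix `shiftSgn A z` is a signed shift of `A`, and it is
positive definite. -/
lemma exists_shiftSgn_eq_smul {d : ℕ} {A : Matrix (Fin d) (Fin d) ℝ} (hA : A.IsHermitian)
    {z : ℝ} (hz : z < lammin A ∨ lammax A < z) :
    ∃ s : ℝ, s ≠ 0 ∧ shiftSgn A z = s • (A - z • 1) ∧ (shiftSgn A z).PosDef := by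
  by_cases h : z < lammin A
  · have hs : shiftSgn A z = (1 : ℝ) • (A - z • 1) := by simp [shiftSgn, h]
    refine ⟨1, one_ne_zero, hs, hs ▸ posDef_smul_sub_smul_one hA fun i => ?_⟩
    have := ciInf_le (Set.finite_range hA.eigenvalues).bddBelow i
    rw [lammin, dif_pos hA] at h
    linarith
  · have hs : shiftSgn A z = (-1 : ℝ) • (A - z • 1) := by simp [shiftSgn, h]
    refine ⟨-1, by norm_num, hs, hs ▸ posDef_smul_sub_smul_one hA fun i => ?_⟩
    have := le_ciSup (Set.finite_range hA.eigenvalues).bddAbove i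
    have h' := hz.resolve_left h
    rw [lammax, dif_pos hA] at h'
    linarith

/-- A best approximation from a subspace in the `M`-norm has `M`-orthogonal error. -/
lemma dotProduct_mulVec_eq_zero_of_forall_mnorm_le {d : ℕ} {M : Matrix (Fin d) (Fin d) ℝ}
    (hM : M.PosSemidef) {K : Submodule ℝ (Fin d → ℝ)} {x y : Fin d → ℝ} (hx : x ∈ K)
    (hmin : ∀ w ∈ K, mnorm M (y - x) ≤ mnorm M (y - w)) {v : Fin d → ℝ} (hv : v ∈ K) :
    v ⬝ᵥ M *ᵥ (y - x) = 0 := by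
  have hnn : ∀ u : Fin d → ℝ, 0 ≤ u ⬝ᵥ M *ᵥ u := fun u => by
    simpa using hM.dotProduct_mulVec_nonneg u
  set e := y - x
  set c := v ⬝ᵥ M *ᵥ e
  set a := v ⬝ᵥ M *ᵥ v
  have ha : 0 ≤ a := hnn v
  have hsymm : e ⬝ᵥ M *ᵥ v = c := by
    have hT : Mᵀ = M := by simpa using hM.isHermitian.eq
    rw [dotProduct_mulVec, ← mulVec_transpose, hT, dotProduct_comm]
  have hquad : ∀ t : ℝ, 0 ≤ t * t * a - 2 * t * c := fun t => by
    have h := hmin (x + t • v) (K.add_mem hx (K.smul_mem t hv))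
    rw [show y - (x + t • v) = e - t • v from by simp only [e]; abel, mnorm, mnorm,
      Real.sqrt_le_sqrt_iff (hnn _)] at h
    simp only [mulVec_sub, mulVec_smul, dotProduct_sub, sub_dotProduct, smul_dotProduct,
      dotProduct_smul, smul_eq_mul, hsymm] at h
    linarith
  have h := hquad (c / (a + 1))
  have h1 : c / (a + 1) * (c / (a + 1)) * a - 2 * (c / (a + 1)) * c
      = -((a + 2) * (c / (a + 1)) ^ 2) := by
    field_simp
    ring
  have h2 : (c / (a + 1)) ^ 2 = 0 := by nlinarith [sq_nonneg (c / (a + 1))]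
  have h3 : a + 1 ≠ 0 := by positivity
  simpa [h3] using h2

/-- If a signed shift of `A` is positive definite, then the same shift of the compression `Qᵀ A Q` by
a matrix `Q` with orthonormal columns is invertible. -/
lemma isUnit_det_transpose_mul_mul_sub_smul_one {d k : ℕ} {A : Matrix (Fin d) (Fin d) ℝ}
    {Q : Matrix (Fin d) (Fin k) ℝ} (hQ : Qᵀ * Q = 1) {s z : ℝ}
    (h : (s • (A - z • 1)).PosDef) : IsUnit (Qᵀ * A * Q - z • 1).det := by
  have hcomp : Qᵀ * (s • (A - z • 1)) * Q = s • (Qᵀ * A * Q - z • 1) := by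
    rw [Matrix.mul_smul, Matrix.smul_mul, Matrix.mul_sub, Matrix.sub_mul, Matrix.mul_smul,
      Matrix.smul_mul, Matrix.mul_one, hQ]
  have hinj : Function.Injective Q.mulVec := fun u v huv => by
    simpa [mulVec_mulVec, hQ] using congrArg (Qᵀ *ᵥ ·) huv
  have hpd : (s • (Qᵀ * A * Q - z • 1)).PosDef := by
    rw [← hcomp]
    simpa using h.conjTranspose_mul_mul_same hinj
  have hdet := hpd.det_pos.ne'
  rw [det_smul] at hdet
  exact isUnit_iff_ne_zero.2 (right_ne_zero_of_mul hdet)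

lemma mij_succ (zs : ℕ → ℝ) (j : ℕ) : mij zs 1 (j + 1) = mij zs 1 j * (X - C (zs (j + 1))) :=
  Finset.prod_Icc_succ_top (by omega) _

/-- Appending the pole `z` multiplies a matrix rational function by `(M - z I)⁻¹`. -/
lemma aeval_mul_inv_mij_succ {m : ℕ} (M : Matrix (Fin m) (Fin m) ℝ) (n : Polynomial ℝ)
    (zs : ℕ → ℝ) (j : ℕ) :
    aeval M n * (aeval M (mij zs 1 (j + 1)))⁻¹
      = (M - zs (j + 1) • 1)⁻¹ * (aeval M n * (aeval M (mij zs 1 j))⁻¹) := by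
  have hX : aeval M (X - C (zs (j + 1))) = M - zs (j + 1) • 1 := by
    simp [Algebra.algebraMap_eq_smul_one]
  have hcomm : Commute (aeval M n) (M - zs (j + 1) • 1)⁻¹ := by
    rw [← hX, ← Matrix.zpow_neg_one]
    exact Matrix.Commute.zpow_right (Commute.map (Commute.all n _) (aeval M)) _
  rw [mij_succ, map_mul, hX, Matrix.mul_inv_rev, ← mul_assoc, hcomm.eq, mul_assoc]

/-- the one-step error recursion for Lanczos-FA,
`err_k(r_j) = (r_j(A)b - opt_k(r_j; A_j)) + Q (T - z_j I)⁻¹ Qᵀ err_k(r_{j-1})`. -/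
theorem lanczosFA_error_recursion
    {d k : ℕ} (A : Matrix (Fin d) (Fin d) ℝ) (hA : A.IsHermitian) (b : Fin d → ℝ)
    (hk : 0 < k) (hdim : Module.finrank ℝ ↥(Krylov A b k) = k)
    (Q : Matrix (Fin d) (Fin k) ℝ) (hQ : Qᵀ * Q = 1)
    (hspan : Submodule.span ℝ
      (Set.range fun i : Fin k => fun j : Fin d => Q j i) = Krylov A b k)
    (zs : ℕ → ℝ) (j : ℕ) (hj : 1 ≤ j)
    (hz : ∀ i, 1 ≤ i → i ≤ j → zs i < lammin A ∨ lammax A < zs i)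
    (n : Polynomial ℝ)
    (xopt : Fin d → ℝ) (hxmem : xopt ∈ Krylov A b k)
    (hxopt : ∀ w ∈ Krylov A b k,
      mnorm (shiftSgn A (zs j))
          ((aeval A n * (aeval A (mij zs 1 j))⁻¹) *ᵥ b - xopt)
        ≤ mnorm (shiftSgn A (zs j))
            ((aeval A n * (aeval A (mij zs 1 j))⁻¹) *ᵥ b - w)) :
    (aeval A n * (aeval A (mij zs 1 j))⁻¹) *ᵥ b
        - (Q * (aeval (Qᵀ * A * Q) n * (aeval (Qᵀ * A * Q) (mij zs 1 j))⁻¹) * Qᵀ) *ᵥ b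
      = ((aeval A n * (aeval A (mij zs 1 j))⁻¹) *ᵥ b - xopt)
        + (Q * (Qᵀ * A * Q - zs j • 1)⁻¹ * Qᵀ) *ᵥ
            ((aeval A n * (aeval A (mij zs 1 (j - 1)))⁻¹) *ᵥ b
              - (Q * (aeval (Qᵀ * A * Q) n
                  * (aeval (Qᵀ * A * Q) (mij zs 1 (j - 1)))⁻¹) * Qᵀ) *ᵥ b) := by
  obtain ⟨j, rfl⟩ : ∃ i, j = i + 1 := ⟨j - 1, by omega⟩
  obtain ⟨s, hs0, hs, hpd⟩ := exists_shiftSgn_eq_smul hA (hz (j + 1) hj le_rfl)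
  have hdetT := isUnit_det_transpose_mul_mul_sub_smul_one hQ (hs ▸ hpd)
  have hdetA : IsUnit (A - zs (j + 1) • 1).det := by
    simpa using isUnit_det_transpose_mul_mul_sub_smul_one
      (Q := (1 : Matrix (Fin d) (Fin d) ℝ)) (by simp) (hs ▸ hpd)
  rw [aeval_mul_inv_mij_succ] at hxopt ⊢
  rw [aeval_mul_inv_mij_succ, Nat.add_sub_cancel]
  set z := zs (j + 1)
  set RA := aeval A n * (aeval A (mij zs 1 j))⁻¹
  set RT := aeval (Qᵀ * A * Q) n * (aeval (Qᵀ * A * Q) (mij zs 1 j))⁻¹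
  have hrange : Krylov A b k = LinearMap.range Q.mulVecLin := by
    rw [← hspan, range_mulVecLin]
    rfl
  obtain ⟨c, rfl⟩ : ∃ c, Q *ᵥ c = xopt := by
    rw [hrange] at hxmem
    exact hxmem
  have horth : Qᵀ *ᵥ ((A - z • 1) *ᵥ (((A - z • 1)⁻¹ * RA) *ᵥ b - Q *ᵥ c)) = 0 := by
    refine dotProduct_eq_zero _ fun u => ?_
    have h := dotProduct_mulVec_eq_zero_of_forall_mnorm_le hpd.posSemidef hxmem hxopt
      (v := Q *ᵥ u) (hrange ▸ ⟨u, rfl⟩)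
    rw [hs, smul_mulVec, dotProduct_smul, smul_eq_mul] at h
    rw [mulVec_transpose, ← dotProduct_mulVec, dotProduct_comm]
    exact (mul_eq_zero.1 h).resolve_left hs0
  have hc : c = (Qᵀ * A * Q - z • 1)⁻¹ *ᵥ (Qᵀ *ᵥ (RA *ᵥ b)) := by
    have hTc : (Qᵀ * A * Q - z • 1) *ᵥ c = Qᵀ *ᵥ (RA *ᵥ b) := by
      have hT : Qᵀ * A * Q - z • 1 = Qᵀ * ((A - z • 1) * Q) := by
        rw [Matrix.sub_mul, Matrix.mul_sub, Matrix.mul_assoc, Matrix.smul_mul, Matrix.mul_smul,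
          Matrix.one_mul, hQ]
      have hRA : (A - z • 1) *ᵥ (((A - z • 1)⁻¹ * RA) *ᵥ b) = RA *ᵥ b := by
        rw [mulVec_mulVec, mul_nonsing_inv_cancel_left _ _ hdetA]
      rw [mulVec_sub, mulVec_sub, hRA, sub_eq_zero] at horth
      rw [horth, hT]
      simp only [mulVec_mulVec]
    rw [← hTc, mulVec_mulVec, nonsing_inv_mul _ hdetT, one_mulVec]
  have hQT : (Q * (Qᵀ * A * Q - z • 1)⁻¹ * Qᵀ) *ᵥ ((Q * RT * Qᵀ) *ᵥ b)
      = (Q * ((Qᵀ * A * Q - z • 1)⁻¹ * RT) * Qᵀ) *ᵥ b := by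
    rw [mulVec_mulVec]
    congr 1
    calc _ = Q * (Qᵀ * A * Q - z • 1)⁻¹ * (Qᵀ * Q) * RT * Qᵀ := by
          simp only [Matrix.mul_assoc]
      _ = _ := by rw [hQ, Matrix.mul_one, Matrix.mul_assoc Q]
  have hQc : Q *ᵥ c = (Q * (Qᵀ * A * Q - z • 1)⁻¹ * Qᵀ) *ᵥ (RA *ᵥ b) := by
    rw [hc]
    simp only [mulVec_mulVec, Matrix.mul_assoc]
  rw [mulVec_sub, hQT, ← hQc]
  abel

end
end

section
/- Let A be a d×d real symmetric matrix, Q a d×k matrix with orthonormal columns (Qᵀ Q = I), and T = Qᵀ A Q. Let m(x) = ∏_{i=1}^{q}(x − z_i) with all z_i real and outside [λmin(A), λmax(A)]. Then m(T) and m(A) are invertible and ‖m(T)^{-1}‖₂ ≤ ‖m(A)^{-1}‖₂, where ‖·‖₂ is the spectral norm. -/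
open Matrix Polynomial

noncomputable section

namespace Matrix

lemma toEuclideanCLM_aeval_of_eigenvector {n : Type*} [Fintype n] [DecidableEq n]
    {M : Matrix n n ℝ} {v : EuclideanSpace ℝ n} {μ : ℝ}
    (h : toEuclideanCLM (𝕜 := ℝ) M v = μ • v) (p : ℝ[X]) :
    toEuclideanCLM (𝕜 := ℝ) (aeval M p) v = p.eval μ • v := by
  induction p using Polynomial.induction_on' with
  | add p q hp hq => simp [hp, hq, add_smul]
  | monomial k a =>
    have hpow : toEuclideanCLM (𝕜 := ℝ) (M ^ k) v = μ ^ k • v := by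
      induction k with
      | zero => simp
      | succ k ih =>
        simp only [map_pow] at ih ⊢
        simp [pow_succ, h, ih, smul_smul, mul_comm]
    rw [aeval_monomial, ← Algebra.smul_def, map_smul, _root_.smul_apply, hpow,
      smul_smul, eval_monomial]

namespace IsHermitian

variable {n : Type*} [Fintype n] [DecidableEq n] {M : Matrix n n ℝ} (hM : M.IsHermitian)
include hM

lemma toEuclideanCLM_aeval_eigenvectorBasis (p : ℝ[X]) (i : n) :
    toEuclideanCLM (𝕜 := ℝ) (aeval M p) (hM.eigenvectorBasis i)
      = p.eval (hM.eigenvalues i) • hM.eigenvectorBasis i := by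
  refine toEuclideanCLM_aeval_of_eigenvector ?_ p
  ext j
  exact congrFun (hM.mulVec_eigenvectorBasis i) j

lemma aeval (p : ℝ[X]) : (aeval M p).IsHermitian := by
  induction p using Polynomial.induction_on' with
  | add p q hp hq => simpa using hp.add hq
  | monomial k a =>
    rw [aeval_monomial, ← Algebra.smul_def]
    simpa [IsHermitian] using congrArg (a • ·) (hM.pow k).eq

/-- If `|p| ≥ c` on the eigenvalues of `M`, then `p(M)` is bounded below by `c`. -/
lemma mul_norm_le_norm_aeval {p : ℝ[X]} {c : ℝ} (hc : 0 ≤ c)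
    (h : ∀ i, c ≤ |p.eval (hM.eigenvalues i)|) (v : EuclideanSpace ℝ n) :
    c * ‖v‖ ≤ ‖toEuclideanCLM (𝕜 := ℝ) (Polynomial.aeval M p) v‖ := by
  have hinner (i : n) :
      inner ℝ (hM.eigenvectorBasis i) (toEuclideanCLM (𝕜 := ℝ) (Polynomial.aeval M p) v)
        = p.eval (hM.eigenvalues i) * inner ℝ (hM.eigenvectorBasis i) v := by
    rw [← real_inner_smul_left, ← hM.toEuclideanCLM_aeval_eigenvectorBasis,
      ← ContinuousLinearMap.adjoint_inner_left, ← ContinuousLinearMap.star_eq_adjoint, ← map_star,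
      star_eq_conjTranspose, hM.aeval p]
  refine le_of_sq_le_sq ?_ (norm_nonneg _)
  rw [mul_pow, ← hM.eigenvectorBasis.sum_sq_norm_inner_right v,
    ← hM.eigenvectorBasis.sum_sq_norm_inner_right (toEuclideanCLM (𝕜 := ℝ) _ v), Finset.mul_sum]
  refine Finset.sum_le_sum fun i _ => ?_
  rw [hinner, norm_mul, mul_pow]
  gcongr
  exact h i

lemma isUnit_aeval_of_le {p : ℝ[X]} {c : ℝ} (hc : 0 < c)
    (h : ∀ i, c ≤ |p.eval (hM.eigenvalues i)|) : IsUnit (Polynomial.aeval M p) := by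
  rw [← mulVec_injective_iff_isUnit, ← coe_mulVecLin, injective_iff_map_eq_zero]
  intro v hv
  have hle := hM.mul_norm_le_norm_aeval hc.le h (WithLp.toLp 2 v)
  rw [toEuclideanCLM_toLp, ← mulVecLin_apply, hv, WithLp.toLp_zero, norm_zero] at hle
  simpa using norm_le_zero_iff.1 (nonpos_of_mul_nonpos_right hle hc)

lemma norm_inv_aeval_le {p : ℝ[X]} {c : ℝ} (hc : 0 < c)
    (h : ∀ i, c ≤ |p.eval (hM.eigenvalues i)|) :
    ‖toEuclideanCLM (𝕜 := ℝ) (Polynomial.aeval M p)⁻¹‖ ≤ c⁻¹ := by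
  have hu : IsUnit (Polynomial.aeval M p) :=
    hM.isUnit_aeval_of_le hc h
  refine ContinuousLinearMap.opNorm_le_bound _ (inv_nonneg.2 hc.le) fun v => ?_
  rw [inv_mul_eq_div, le_div_iff₀' hc]
  refine (hM.mul_norm_le_norm_aeval hc.le h _).trans_eq ?_
  rw [← mul_apply_eq_comp, ← map_mul,
    mul_nonsing_inv _ ((isUnit_iff_isUnit_det _).1 hu), map_one, one_apply_eq_self]

lemma inv_abs_eval_le_norm_inv_aeval {p : ℝ[X]} (hu : IsUnit (Polynomial.aeval M p)) (i : n) :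
    |p.eval (hM.eigenvalues i)|⁻¹ ≤ ‖toEuclideanCLM (𝕜 := ℝ) (Polynomial.aeval M p)⁻¹‖ := by
  set μ := p.eval (hM.eigenvalues i)
  set e := hM.eigenvectorBasis i
  have he : e = μ • toEuclideanCLM (𝕜 := ℝ) (Polynomial.aeval M p)⁻¹ e := by
    rw [← map_smul, ← hM.toEuclideanCLM_aeval_eigenvectorBasis, ← mul_apply_eq_comp,
      ← map_mul, nonsing_inv_mul _ ((isUnit_iff_isUnit_det _).1 hu), map_one,
      one_apply_eq_self]
  have hnorm : ‖e‖ = 1 := hM.eigenvectorBasis.norm_eq_one i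
  have hone : 1 = |μ| * ‖toEuclideanCLM (𝕜 := ℝ) (Polynomial.aeval M p)⁻¹ e‖ := by
    rw [← Real.norm_eq_abs, ← norm_smul, ← he, hnorm]
  rw [inv_eq_of_mul_eq_one_right hone.symm]
  simpa [hnorm] using
    (toEuclideanCLM (𝕜 := ℝ) (Polynomial.aeval M p)⁻¹).le_opNorm e

open scoped MatrixOrder in
/-- The eigenvalues of a compression lie in every interval containing those of the matrix. -/
lemma eigenvalues_compression_mem_Icc {m : Type*} [Fintype m] [DecidableEq m] {Q : Matrix n m ℝ}
    (hQ : Qᵀ * Q = 1) {l u : ℝ} (h : ∀ i, hM.eigenvalues i ∈ Set.Icc l u)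
    (hT : (Qᵀ * M * Q).IsHermitian) (j : m) : hT.eigenvalues j ∈ Set.Icc l u := by
  have hspec (x) (hx : x ∈ spectrum ℝ M) : x ∈ Set.Icc l u := by
    obtain ⟨i, rfl⟩ := hM.spectrum_real_eq_range_eigenvalues ▸ hx
    exact h i
  have hcompr (r : ℝ) : Qᵀ * algebraMap ℝ (Matrix n n ℝ) r * Q = algebraMap ℝ (Matrix m m ℝ) r := by
    simp [Algebra.algebraMap_eq_smul_one, hQ]
  have hmono {B C : Matrix n n ℝ} (hBC : B ≤ C) : Qᵀ * B * Q ≤ Qᵀ * C * Q := by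
    rw [le_iff] at hBC ⊢
    simpa only [conjTranspose_eq_transpose_of_trivial, Matrix.mul_sub, Matrix.sub_mul] using
      hBC.conjTranspose_mul_mul_same Q
  have hl := hmono (algebraMap_le_of_le_spectrum (fun x hx => (hspec x hx).1) hM)
  have hu := hmono (le_algebraMap_of_spectrum_le (fun x hx => (hspec x hx).2) hM)
  rw [hcompr] at hl hu
  exact ⟨(algebraMap_le_iff_le_spectrum hT).1 hl _ (hT.eigenvalues_mem_spectrum_real j),
    (le_algebraMap_iff_spectrum_le hT).1 hu _ (hT.eigenvalues_mem_spectrum_real j)⟩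

end IsHermitian

end Matrix

/-- The modulus of a real-rooted polynomial with no root in `[l, u]` is minimal at an endpoint. -/
lemma min_abs_prod_sub_le {ι : Type*} (s : Finset ι) (z : ι → ℝ) {l u x : ℝ}
    (hz : ∀ i ∈ s, z i < l ∨ u < z i) (hx : x ∈ Set.Icc l u) :
    min |∏ i ∈ s, (l - z i)| |∏ i ∈ s, (u - z i)| ≤ |∏ i ∈ s, (x - z i)| := by
  have hlu : l ≤ u := hx.1.trans hx.2
  obtain ⟨a, b, ha, hb, hab, rfl⟩ := (segment_eq_Icc hlu ▸ hx : x ∈ segment ℝ l u)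
  simp only [smul_eq_mul, Finset.abs_prod]
  set L := ∏ i ∈ s, |l - z i|
  set U := ∏ i ∈ s, |u - z i|
  have hL : 0 ≤ L := Finset.prod_nonneg fun i _ => abs_nonneg _
  have hU : 0 ≤ U := Finset.prod_nonneg fun i _ => abs_nonneg _
  have hm : 0 ≤ min L U := le_min hL hU
  calc min L U = min L U ^ a * min L U ^ b := by
        rw [← Real.rpow_add_of_nonneg hm ha hb, hab, Real.rpow_one]
    _ ≤ L ^ a * U ^ b := by
        gcongr
        exacts [min_le_left _ _, min_le_right _ _]
    _ = ∏ i ∈ s, |l - z i| ^ a * |u - z i| ^ b := by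
        rw [Finset.prod_mul_distrib, Real.finsetProd_rpow _ _ fun i _ => abs_nonneg _,
          Real.finsetProd_rpow _ _ fun i _ => abs_nonneg _]
    _ ≤ ∏ i ∈ s, |a * l + b * u - z i| := by
        refine Finset.prod_le_prod (fun i _ => by positivity) fun i hi => ?_
        refine (Real.geom_mean_le_arith_mean2_weighted ha hb (abs_nonneg _) (abs_nonneg _)
          hab).trans_eq ?_
        have hsplit : a * l + b * u - z i = a * (l - z i) + b * (u - z i) := by
          linear_combination z i * hab
        rw [hsplit]
        rcases hz i hi with h | h
        · rw [abs_of_pos (by linarith), abs_of_pos (by linarith), abs_of_nonneg]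
          exact add_nonneg (mul_nonneg ha (by linarith)) (mul_nonneg hb (by linarith))
        · rw [abs_of_neg (by linarith), abs_of_neg (by linarith), abs_of_nonpos]
          · ring
          · exact add_nonpos (mul_nonpos_of_nonneg_of_nonpos ha (by linarith))
              (mul_nonpos_of_nonneg_of_nonpos hb (by linarith))

lemma eval_mij (zs : ℕ → ℝ) (i j : ℕ) (x : ℝ) :
    (mij zs i j).eval x = ∏ t ∈ Finset.Icc i j, (x - zs t) := by
  simp [mij, eval_prod]

lemma eigenvalues_mem_Icc_lammin_lammax {d : ℕ} {A : Matrix (Fin d) (Fin d) ℝ}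
    (hA : A.IsHermitian) (i : Fin d) : hA.eigenvalues i ∈ Set.Icc (lammin A) (lammax A) := by
  rw [lammin, lammax, dif_pos hA, dif_pos hA]
  exact ⟨ciInf_le (Set.finite_range _).bddBelow i, le_ciSup (Set.finite_range _).bddAbove i⟩

lemma lammin_le_lammax {d : ℕ} {A : Matrix (Fin d) (Fin d) ℝ} (hA : A.IsHermitian) :
    lammin A ≤ lammax A := by
  rcases isEmpty_or_nonempty (Fin d) with _ | ⟨⟨i⟩⟩
  · simp [lammin, lammax]
  · exact (eigenvalues_mem_Icc_lammin_lammax hA i).1.trans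
      (eigenvalues_mem_Icc_lammin_lammax hA i).2

/-- for `T = Qᵀ A Q` with orthonormal `Q` and `m` a polynomial with real
roots outside `[λmin(A), λmax(A)]`, both `m(T)` and `m(A)` are invertible and
`‖m(T)⁻¹‖₂ ≤ ‖m(A)⁻¹‖₂`. -/
theorem specNorm_inv_compression_le
    {d k q : ℕ} (A : Matrix (Fin d) (Fin d) ℝ) (hA : A.IsHermitian)
    (Q : Matrix (Fin d) (Fin k) ℝ) (hQ : Qᵀ * Q = 1)
    (zs : ℕ → ℝ)
    (hz : ∀ i, 1 ≤ i → i ≤ q → zs i < lammin A ∨ lammax A < zs i) :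
    IsUnit (aeval (Qᵀ * A * Q) (mij zs 1 q))
    ∧ IsUnit (aeval A (mij zs 1 q))
    ∧ specNorm ((aeval (Qᵀ * A * Q) (mij zs 1 q))⁻¹)
        ≤ specNorm ((aeval A (mij zs 1 q))⁻¹) := by
  have hT : (Qᵀ * A * Q).IsHermitian := by
    simpa using isHermitian_conjTranspose_mul_mul Q hA
  have hz' : ∀ t ∈ Finset.Icc 1 q, zs t < lammin A ∨ lammax A < zs t := fun t ht =>
    hz t (Finset.mem_Icc.1 ht).1 (Finset.mem_Icc.1 ht).2
  have hlu := lammin_le_lammax hA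
  set p := mij zs 1 q with hp
  set c := min |p.eval (lammin A)| |p.eval (lammax A)| with hc_def
  have hle {x : ℝ} (hx : x ∈ Set.Icc (lammin A) (lammax A)) : c ≤ |p.eval x| := by
    simp only [hc_def, hp, eval_mij]
    exact min_abs_prod_sub_le _ zs hz' hx
  have hc : 0 < c := by
    simp only [hc_def, hp, eval_mij, lt_min_iff, abs_pos, Finset.prod_ne_zero_iff, sub_ne_zero]
    constructor <;> intro t ht <;> rcases hz' t ht with h | h
    exacts [h.ne', (hlu.trans_lt h).ne, (h.trans_le hlu).ne', h.ne]
  have hAc i : c ≤ |p.eval (hA.eigenvalues i)| := hle (eigenvalues_mem_Icc_lammin_lammax hA i)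
  have hTc j : c ≤ |p.eval (hT.eigenvalues j)| :=
    hle (hA.eigenvalues_compression_mem_Icc hQ (eigenvalues_mem_Icc_lammin_lammax hA) hT j)
  have huA := hA.isUnit_aeval_of_le hc hAc
  refine ⟨hT.isUnit_aeval_of_le hc hTc, huA, ?_⟩
  rcases isEmpty_or_nonempty (Fin d) with _ | _
  · have : IsEmpty (Fin k) := ⟨fun j => by simpa [mul_apply] using congrFun (congrFun hQ j) j⟩
    rw [Subsingleton.elim (aeval (Qᵀ * A * Q) p)⁻¹ 0]
    simp [specNorm]
  · refine (hT.norm_inv_aeval_le hc hTc).trans ?_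
    obtain ⟨i, hi⟩ := exists_eq_ciInf_of_finite (f := hA.eigenvalues)
    obtain ⟨j, hj⟩ := exists_eq_ciSup_of_finite (f := hA.eigenvalues)
    rcases min_choice |p.eval (lammin A)| |p.eval (lammax A)| with h | h
    · rw [hc_def, h, lammin, dif_pos hA, ← hi]
      exact hA.inv_abs_eval_le_norm_inv_aeval huA i
    · rw [hc_def, h, lammax, dif_pos hA, ← hj]
      exact hA.inv_abs_eval_le_norm_inv_aeval huA j

end
end

section
/- Let k be a positive integer and let λ_1 < λ_2 < ⋯ < λ_{k+1} be real numbers. Then there exist positive reals w_1, …, w_{k+1} with Σ_{i=1}^{k+1} w_i = 1 such that Σ_{i=1}^{k+1} (−1)^{i−1} w_i λ_i^j = 0 for every j = 0, 1, …, k−1. In particular, the choice w_ℓ proportional to ∏_{1 ≤ i < j ≤ k+1, i ≠ ℓ, j ≠ ℓ} (λ_j − λ_i) satisfies these conditions. -/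
open Matrix Polynomial

noncomputable section

/-- The Vandermonde determinant of the nodes other than `ℓ`, as a product over pairs of nodes. -/
theorem det_vandermonde_succAbove {R : Type*} [CommRing R] {k : ℕ} (v : Fin (k + 1) → R)
    (ℓ : Fin (k + 1)) :
    (Matrix.vandermonde (v ∘ ℓ.succAbove)).det =
      ∏ pr ∈ Finset.univ.filter
          (fun pr : Fin (k + 1) × Fin (k + 1) => pr.1 < pr.2 ∧ pr.1 ≠ ℓ ∧ pr.2 ≠ ℓ),
        (v pr.2 - v pr.1) := by
  rw [Matrix.det_vandermonde, Finset.prod_sigma']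
  refine Finset.prod_nbij (fun x => (ℓ.succAbove x.1, ℓ.succAbove x.2)) ?_ ?_ ?_ ?_
  · rintro ⟨i, j⟩ h
    simpa [Fin.succAbove_ne] using h
  · rintro ⟨i, j⟩ - ⟨i', j'⟩ - h
    simpa using h
  · rintro ⟨a, b⟩ h
    obtain ⟨hab, ha, hb⟩ : a < b ∧ a ≠ ℓ ∧ b ≠ ℓ := by simpa using h
    obtain ⟨i, rfl⟩ := Fin.exists_succAbove_eq ha
    obtain ⟨j, rfl⟩ := Fin.exists_succAbove_eq hb
    exact ⟨⟨i, j⟩, by simpa using hab, rfl⟩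
  · rintro ⟨i, j⟩ -
    rfl

/-- The alternating moments of order less than `k`, weighted by the Vandermonde minors of
`k + 1` nodes, vanish. -/
theorem sum_neg_one_pow_mul_det_vandermonde_succAbove_mul_pow {R : Type*} [CommRing R] {k : ℕ}
    (v : Fin (k + 1) → R) {j : ℕ} (hj : j < k) :
    ∑ i : Fin (k + 1),
      (-1 : R) ^ (i : ℕ) * (Matrix.vandermonde (v ∘ i.succAbove)).det * v i ^ j = 0 := by
  let M : Matrix (Fin (k + 1)) (Fin (k + 1)) R :=
    Matrix.of fun i => Fin.cons (v i ^ j) fun m : Fin k => v i ^ (m : ℕ)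
  have hM : M.det = 0 :=
    Matrix.det_zero_of_column_eq (i := 0) (j := Fin.succ ⟨j, hj⟩) (Fin.succ_ne_zero _).symm
      fun _ => rfl
  rw [Matrix.det_succ_column_zero] at hM
  rw [← hM]
  refine Finset.sum_congr rfl fun i _ => ?_
  have hsub : M.submatrix i.succAbove Fin.succ = Matrix.vandermonde (v ∘ i.succAbove) := by
    ext a b
    simp [M, Matrix.vandermonde_apply]
  rw [hsub]
  simp only [M, Matrix.of_apply, Fin.cons_zero]
  ring

/-- existence of positive weights summing to one whose alternating moments
vanish up to order `k - 1`; the explicit choice `w_ℓ ∝ ∏_{i<j, i≠ℓ, j≠ℓ} (λ_j - λ_i)` works. -/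
theorem exists_positive_weights_alternating_moments
    (k : ℕ) (hk : 0 < k) (lam : Fin (k + 1) → ℝ) (hmono : StrictMono lam) :
    (∃ w : Fin (k + 1) → ℝ, (∀ i, 0 < w i) ∧ (∑ i, w i = 1) ∧
      ∀ j < k, ∑ i : Fin (k + 1), (-1 : ℝ) ^ (i : ℕ) * w i * lam i ^ j = 0)
    ∧ (let P : Fin (k + 1) → ℝ := fun ℓ =>
          ∏ pr ∈ Finset.univ.filter
              (fun pr : Fin (k + 1) × Fin (k + 1) => pr.1 < pr.2 ∧ pr.1 ≠ ℓ ∧ pr.2 ≠ ℓ),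
            (lam pr.2 - lam pr.1);
        let w : Fin (k + 1) → ℝ := fun ℓ => P ℓ / ∑ m, P m;
        (∀ i, 0 < w i) ∧ (∑ i, w i = 1) ∧
          ∀ j < k, ∑ i : Fin (k + 1), (-1 : ℝ) ^ (i : ℕ) * w i * lam i ^ j = 0) := by
  refine (and_iff_right_of_imp fun h => ⟨_, h⟩).2 ?_
  intro P w
  have hP : ∀ ℓ, 0 < P ℓ := fun ℓ => Finset.prod_pos fun pr hpr =>
    sub_pos.2 (hmono (Finset.mem_filter.1 hpr).2.1)
  have hS : 0 < ∑ m, P m := Finset.sum_pos (fun m _ => hP m) Finset.univ_nonempty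
  refine ⟨fun i => div_pos (hP i) hS, ?_, fun j hj => ?_⟩
  · rw [← Finset.sum_div, div_self hS.ne']
  · have h := sum_neg_one_pow_mul_det_vandermonde_succAbove_mul_pow lam hj
    simp only [det_vandermonde_succAbove] at h
    calc ∑ i : Fin (k + 1), (-1 : ℝ) ^ (i : ℕ) * w i * lam i ^ j
        = (∑ i : Fin (k + 1), (-1 : ℝ) ^ (i : ℕ) * P i * lam i ^ j) / ∑ m, P m := by
          rw [Finset.sum_div]
          exact Finset.sum_congr rfl fun i _ => by simp only [w]; ring
      _ = 0 := by rw [h, zero_div]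

end
end

section
/- For every positive integer k, e·√k ≤ e / √(1 − e^{−1/k}) ≤ e·√k + 1/√k, where e is Euler's number. -/
open Matrix Polynomial

noncomputable section

/-- Rational lower bound for `1 - exp (-1 / K)` coming from the quadratic Taylor bound on `exp`. -/
lemma one_sub_exp_neg_inv_ge {K : ℝ} (hK : 0 < K) :
    (2 * K + 1) / (2 * K ^ 2 + 2 * K + 1) ≤ 1 - Real.exp (-1 / K) := by
  have hq := Real.quadratic_le_exp_of_nonneg (x := 1 / K) (by positivity)
  have hrat : 1 + 1 / K + (1 / K) ^ 2 / 2 = (2 * K ^ 2 + 2 * K + 1) / (2 * K ^ 2) := by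
    field_simp
  have hinv : Real.exp (-1 / K) ≤ 2 * K ^ 2 / (2 * K ^ 2 + 2 * K + 1) := by
    rw [neg_div, Real.exp_neg, ← inv_div (2 * K ^ 2 + 2 * K + 1)]
    rw [hrat] at hq
    exact inv_anti₀ (by positivity) hq
  have hsplit : (2 * K + 1) / (2 * K ^ 2 + 2 * K + 1)
      = 1 - 2 * K ^ 2 / (2 * K ^ 2 + 2 * K + 1) := by
    field_simp
    ring
  linarith

lemma mul_exp_one_sq_div_le {K : ℝ} (hK : 0 < K) :
    K * Real.exp 1 ^ 2 / (Real.exp 1 * K + 1) ^ 2 ≤ 1 - Real.exp (-1 / K) := by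
  refine le_trans ?_ (one_sub_exp_neg_inv_ge hK)
  have hpos := Real.exp_pos 1
  have hlt : Real.exp 1 < 2.72 := Real.exp_one_lt_d9.trans (by norm_num)
  rw [div_le_div_iff₀ (by positivity) (by positivity)]
  generalize Real.exp 1 = e at *
  have hquad : 0 ≤ e * (4 - e) := mul_nonneg hpos.le (by linarith)
  have hlin : 0 ≤ 2 * e + 2 - e ^ 2 := by nlinarith
  nlinarith [mul_nonneg (sq_nonneg K) hquad, mul_nonneg hK.le hlin]

/-- for every positive integer `k`,
`e·√k ≤ e / √(1 − e^{−1/k}) ≤ e·√k + 1/√k`. -/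
theorem exp_sqrt_inequality (k : ℕ) (hk : 0 < k) :
    Real.exp 1 * Real.sqrt k
        ≤ Real.exp 1 / Real.sqrt (1 - Real.exp (-1 / (k : ℝ)))
    ∧ Real.exp 1 / Real.sqrt (1 - Real.exp (-1 / (k : ℝ)))
        ≤ Real.exp 1 * Real.sqrt k + 1 / Real.sqrt k := by
  have hK : (0 : ℝ) < k := by exact_mod_cast hk
  generalize (k : ℝ) = K at *
  have hs : 0 < √K := Real.sqrt_pos.2 hK
  have he := Real.exp_pos 1
  have hlower := mul_exp_one_sq_div_le hK
  have hy : 0 < 1 - Real.exp (-1 / K) := lt_of_lt_of_le (by positivity) hlower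
  have ht := Real.sqrt_pos.2 hy
  constructor
  · rw [le_div_iff₀ ht, mul_assoc, ← Real.sqrt_mul hK.le]
    refine mul_le_of_le_one_right he.le (Real.sqrt_le_one.2 ?_)
    have hle : 1 - Real.exp (-1 / K) ≤ 1 / K := by
      have := Real.add_one_le_exp (-1 / K)
      rw [neg_div] at this ⊢
      linarith
    rw [le_div_iff₀ hK] at hle
    linarith
  · have hsqrt : √K * Real.exp 1 / (Real.exp 1 * K + 1) ≤ √(1 - Real.exp (-1 / K)) := by
      apply Real.le_sqrt_of_sq_le
      rwa [div_pow, mul_pow, Real.sq_sqrt hK.le]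
    have hsum : Real.exp 1 * √K + 1 / √K = (Real.exp 1 * K + 1) / √K := by
      rw [eq_div_iff hs.ne', add_mul, mul_assoc, Real.mul_self_sqrt hK.le,
        one_div_mul_cancel hs.ne']
    rw [hsum, div_le_div_iff₀ ht hs]
    rw [div_le_iff₀ (by positivity)] at hsqrt
    linarith

end
end
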